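/- arXiv:2603.12484 — 2 statements merged into one kernel-verified Lean document; each statement's English description precedes it below -/
import Mathlib

section
/- Let f : X → Y be a morphism of schemes of finite type and let S ⊆ X be a constructible subset of the underlying topological space of X. Then there exists a dense open subset U ⊆ Y such that for every point y ∈ U, the intersection of the closure of S in X with the fiber f⁻¹(y) equals the closure of S ∩ f⁻¹(y) taken in the subspace topology of f⁻¹(y). -/
open AlgebraicGeometry

/-- An open subset is retrocompact if its intersection with every compact open is compact. -/
def IsRetrocompactOpen {X : Type*} [TopologicalSpace X] (U : Set X) : Prop :=
  IsOpen U ∧ ∀ ⦃V : Set X⦄, IsOpen V → IsCompact V → IsCompact (U ∩ V)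

/-- A set is constructible if it is a finite union of differences of retrocompact opens. -/
def IsConstructibleSet {X : Type*} [TopologicalSpace X] (S : Set X) : Prop :=
  ∃ F : Finset (Set X × Set X),
    (∀ p ∈ F, IsRetrocompactOpen p.1 ∧ IsRetrocompactOpen p.2) ∧
    S = ⋃ p ∈ F, p.1 \ p.2

namespace GenFib
open MvPolynomial

/-- `a` has a power which is the top coefficient (at `μ`) of an element of `I`. -/
def Lead {A σ : Type*} [CommRing A] (m : MonomialOrder σ) (I : Ideal (MvPolynomial σ A))
    (c : A) (μ : σ →₀ ℕ) : Prop :=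
  ∃ w ∈ I, (∀ ν, m.toSyn μ < m.toSyn ν → w.coeff ν = 0) ∧ w.coeff μ = c

lemma Lead.mul {A σ : Type*} [CommRing A] {m : MonomialOrder σ} {I : Ideal (MvPolynomial σ A)}
    {c : A} {μ : σ →₀ ℕ} (h : Lead m I c μ) (d : A) : Lead m I (d * c) μ := by
  obtain ⟨w, hw, h1, h2⟩ := h
  refine ⟨C d * w, I.mul_mem_left _ hw, fun ν hν => ?_, ?_⟩
  · rw [coeff_C_mul, h1 ν hν, mul_zero]
  · rw [coeff_C_mul, h2]

lemma Lead.up {A σ : Type*} [CommRing A] {m : MonomialOrder σ} {I : Ideal (MvPolynomial σ A)}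
    {c : A} {μ ν : σ →₀ ℕ} (h : Lead m I c μ) (hμν : μ ≤ ν) : Lead m I c ν := by
  obtain ⟨w, hw, h1, h2⟩ := h
  obtain ⟨δ, rfl⟩ := exists_add_of_le hμν
  refine ⟨w * monomial δ 1, I.mul_mem_right _ hw, fun ν hν => ?_, ?_⟩
  · rw [coeff_mul_monomial']
    split_ifs with hd
    · obtain ⟨ε, rfl⟩ := exists_add_of_le hd
      rw [add_tsub_cancel_left, h1, zero_mul]
      rw [map_add, map_add, add_comm] at hν
      exact lt_of_add_lt_add_left hν
    · rfl
  · rw [coeff_mul_monomial', if_pos (by simp), add_tsub_cancel_right, h2, mul_one]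

lemma exists_good {A σ : Type*} [CommRing A] [Finite σ] (m : MonomialOrder σ)
    (I : Ideal (MvPolynomial σ A)) (a₀ : A) (h₀ : ¬ IsNilpotent a₀) :
    ∃ a, a₀ ∣ a ∧ ¬ IsNilpotent a ∧ ∀ μ, (∃ k : ℕ, Lead m I (a ^ k) μ) ∨
      ∀ c, Lead m I c μ → IsNilpotent (a * c) := by
  by_contra! H
  let T := {a : A // a₀ ∣ a ∧ ¬ IsNilpotent a}
  have step : ∀ a : T, ∃ b : T, ∃ μ, a.1 ∣ b.1 ∧ (∀ k : ℕ, ¬ Lead m I (a.1 ^ k) μ) ∧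
      Lead m I b.1 μ := by
    intro a
    obtain ⟨μ, h1, c, h2, h3⟩ := H a.1 a.2.1 a.2.2
    exact ⟨⟨a.1 * c, a.2.1.mul_right _, h3⟩, μ, dvd_mul_right _ _, h1, h2.mul _⟩
  choose nx μ hd hn hl using step
  let s : ℕ → T := fun n => nx^[n] ⟨a₀, dvd_rfl, h₀⟩
  have hs : ∀ n, s (n + 1) = nx (s n) := fun n => Function.iterate_succ_apply' _ _ _
  have hmono : ∀ i j, i ≤ j → (s i).1 ∣ (s j).1 := by
    intro i j hij
    induction j, hij using Nat.le_induction with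
    | base => exact dvd_rfl
    | succ n _ ih => rw [hs]; exact ih.trans (hd _)
  obtain ⟨i, j, hij, hle⟩ := wellQuasiOrdered_le (fun n => μ (s n))
  refine hn (s j) 1 ?_
  have h1 : Lead m I (s (i + 1)).1 (μ (s i)) := by rw [hs]; exact hl _
  obtain ⟨d, hd'⟩ := hmono (i + 1) j hij
  rw [pow_one, hd', mul_comm]
  exact (h1.mul d).up hle

lemma lemmaA {A σ : Type*} [CommRing A] [Finite σ]
    (I : Ideal (MvPolynomial σ A)) (hI : (nilradical A).map C ≤ I)
    (a₀ : A) (h₀ : ¬ IsNilpotent a₀) :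
    ∃ a, a₀ ∣ a ∧ ¬ IsNilpotent a ∧ ∀ q : Ideal A, q.IsPrime → ∀ v ∈ I, v ∈ q.map C →
      ∃ k : ℕ, C a ^ k * v ∈ q.map C * I ⊔ (nilradical A).map C := by
  classical
  obtain ⟨m⟩ : Nonempty (MonomialOrder σ) := by
    let : LinearOrder σ := linearOrderOfSTO WellOrderingRel
    exact ⟨MonomialOrder.lex⟩
  obtain ⟨a, hd, hn, ha⟩ := exists_good m I a₀ h₀
  refine ⟨a, hd, hn, fun q hq => ?_⟩
  suffices H : ∀ s : m.syn, ∀ v ∈ I, v ∈ q.map C → m.toSyn (m.degree v) = s →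
      ∃ k : ℕ, C a ^ k * v ∈ q.map C * I ⊔ (nilradical A).map C from
    fun v h1 h2 => H _ v h1 h2 rfl
  intro s
  induction s using WellFoundedLT.induction with
  | ind s ih =>
  intro v hvI hvq hs
  set μ := m.degree v with hμ
  set c := v.coeff μ with hc
  have hcq : c ∈ q := mem_map_C_iff.1 hvq μ
  have hv0 : ∀ ν, m.toSyn μ < m.toSyn ν → v.coeff ν = 0 := fun ν hν =>
    m.coeff_eq_zero_of_lt hν
  -- it suffices to subtract off the leading term
  have key : ∀ (k : ℕ) (w : MvPolynomial σ A), w ∈ I → w ∈ q.map C →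
      w ∈ q.map C * I ⊔ (nilradical A).map C →
      (∀ ν, m.toSyn μ < m.toSyn ν → w.coeff ν = 0) → w.coeff μ = a ^ k * c →
      ∃ k : ℕ, C a ^ k * v ∈ q.map C * I ⊔ (nilradical A).map C := by
    intro k w h1 h2 h3 h4 h5
    set v' := C a ^ k * v - w with hv'
    have e1 : v' ∈ I := I.sub_mem (I.mul_mem_left _ hvI) h1
    have e2 : v' ∈ q.map C := Ideal.sub_mem _ (Ideal.mul_mem_left _ _ hvq) h2
    have hcoeff : ∀ ν, m.toSyn μ ≤ m.toSyn ν → v'.coeff ν = 0 := by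
      intro ν hν
      rw [hv', coeff_sub, ← C_pow, coeff_C_mul]
      rcases hν.lt_or_eq with h | h
      · rw [hv0 ν h, h4 ν h]; simp
      · rw [← m.toSyn.injective h, h5, ← hc, sub_self]
    have e3 : ∃ l : ℕ, C a ^ l * v' ∈ q.map C * I ⊔ (nilradical A).map C := by
      by_cases hz : v' = 0
      · exact ⟨0, by rw [hz, mul_zero]; exact zero_mem _⟩
      · refine ih _ ?_ v' e1 e2 rfl
        by_contra hlt
        rw [not_lt, ← hs] at hlt
        exact m.coeff_degree_ne_zero_iff.2 hz (hcoeff _ hlt)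
    obtain ⟨l, hl⟩ := e3
    refine ⟨l + k, ?_⟩
    have : C a ^ (l + k) * v = C a ^ l * v' + C a ^ l * w := by rw [hv']; ring
    rw [this]
    exact Ideal.add_mem _ hl (Ideal.mul_mem_left _ _ h3)
  rcases ha μ with ⟨k, w, hw, h1, h2⟩ | h
  · have hCc : C c ∈ q.map (C : A →+* MvPolynomial σ A) := Ideal.mem_map_of_mem _ hcq
    refine key k (C c * w) (I.mul_mem_left _ hw) (Ideal.mul_mem_right _ _ hCc)
      (Ideal.mem_sup_left (Ideal.mul_mem_mul hCc hw)) (fun ν hν => ?_) ?_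
    · rw [coeff_C_mul, h1 ν hν, mul_zero]
    · rw [coeff_C_mul, h2, mul_comm]
  · have hnil : a * c ∈ nilradical A := h c ⟨v, hvI, hv0, rfl⟩
    have hmem : monomial μ (a * c) ∈ (nilradical A).map (C : A →+* MvPolynomial σ A) := by
      rw [mem_map_C_iff]
      intro ν
      rw [coeff_monomial]
      split_ifs
      · exact hnil
      · exact zero_mem _
    refine key 1 (monomial μ (a * c)) (hI hmem)
      (Ideal.map_mono (nilradical_le_prime q) hmem) (Ideal.mem_sup_right hmem) (fun ν hν => ?_) ?_
    · rw [coeff_monomial, if_neg]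
      rintro rfl
      exact lt_irrefl _ hν
    · rw [coeff_monomial, if_pos rfl, pow_one]

lemma lemmaB {A B : Type*} [CommRing A] [CommRing B] [Algebra A B] [Algebra.FiniteType A B]
    (hAB : ∀ x : A, IsNilpotent x → algebraMap A B x = 0) (G : B) (hG : G ∈ nonZeroDivisors B) (a₀ : A) (h₀ : ¬ IsNilpotent a₀) :
    ∃ a, a₀ ∣ a ∧ ¬ IsNilpotent a ∧ ∀ q : Ideal A, q.IsPrime → ∀ b : B,
      b * G ∈ q.map (algebraMap A B) →
      ∃ k : ℕ, algebraMap A B a ^ k * b ∈ q.map (algebraMap A B) := by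
  obtain ⟨n, φ, hφ⟩ := Algebra.FiniteType.iff_quotient_mvPolynomial''.1
    (inferInstance : Algebra.FiniteType A B)
  have hφ' : Function.Surjective (φ : MvPolynomial (Fin n) A →+* B) := hφ
  have hcomp : (φ : MvPolynomial (Fin n) A →+* B).comp C = algebraMap A B := φ.comp_algebraMap
  have hmap : ∀ q : Ideal A, (q.map C).map (φ : MvPolynomial (Fin n) A →+* B)
      = q.map (algebraMap A B) := fun q => by rw [Ideal.map_map, hcomp]
  have hnil : (nilradical A).map (algebraMap A B) = ⊥ := by
    rw [eq_bot_iff, Ideal.map_le_iff_le_comap]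
    intro x hx
    exact hAB x (mem_nilradical.1 hx)
  set I := (Ideal.span {G}).comap (φ : MvPolynomial (Fin n) A →+* B) with hI
  have hIm : I.map (φ : MvPolynomial (Fin n) A →+* B) = Ideal.span {G} :=
    Ideal.map_comap_of_surjective _ hφ' _
  obtain ⟨a, h1, h2, h3⟩ := lemmaA I (by
    rw [hI, ← Ideal.map_le_iff_le_comap, hmap, hnil]; exact bot_le) a₀ h₀
  refine ⟨a, h1, h2, fun q hq b hb => ?_⟩
  rw [← hmap, Ideal.mem_map_iff_of_surjective _ hφ'] at hb
  obtain ⟨v, hv, hvb⟩ := hb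
  obtain ⟨k, hk⟩ := h3 q hq v (by
    rw [hI, Ideal.mem_comap, hvb]; exact Ideal.mem_span_singleton'.2 ⟨b, rfl⟩) hv
  refine ⟨k, ?_⟩
  have := Ideal.mem_map_of_mem (φ : MvPolynomial (Fin n) A →+* B) hk
  rw [Ideal.map_sup, Ideal.map_mul, hmap, hmap, hnil, sup_bot_eq, hIm, map_mul, hvb,
    Ideal.mem_mul_span_singleton] at this
  obtain ⟨z, hz, hzG⟩ := this
  have hC : (φ : MvPolynomial (Fin n) A →+* B) (C a ^ k) = algebraMap A B a ^ k := by
    rw [map_pow, ← hcomp]; rfl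
  rw [hC, ← mul_assoc] at hzG
  rwa [← (mul_cancel_right_mem_nonZeroDivisors hG).1 hzG]

open Polynomial in
lemma lemmaC {A B : Type*} [CommRing A] [CommRing B] [Algebra A B] [Algebra.FiniteType A B]
    [IsReduced B] (t : Finset B) (ht : ∀ b : B, (∀ g ∈ t, b * g = 0) → b = 0)
    (a₀ : A) (h₀ : ¬ IsNilpotent a₀) :
    ∃ a, a₀ ∣ a ∧ ¬ IsNilpotent a ∧ ∀ q : Ideal A, q.IsPrime → ∀ b : B,
      (∀ g ∈ t, b * g ∈ q.map (algebraMap A B)) →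
      ∃ k : ℕ, algebraMap A B a ^ k * b ∈ q.map (algebraMap A B) := by
  classical
  have e := t.equivFin
  let G : B[X] := ∑ i : Fin t.card, Polynomial.monomial i.1 (e.symm i).1
  have hGc : ∀ i : Fin t.card, G.coeff i = (e.symm i).1 := by
    intro i
    simp only [G, Polynomial.finsetSum_coeff, Polynomial.coeff_monomial]
    rw [Finset.sum_eq_single i]
    · simp
    · intro j _ hj
      rw [if_neg]
      exact fun h => hj (Fin.ext h)
    · simp
  have hG : G ∈ nonZeroDivisors B[X] := by
    rw [Polynomial.mem_nonZeroDivisors_iff]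
    intro b hb
    refine ht b fun g hg => ?_
    have := congrArg (fun p => Polynomial.coeff p (e ⟨g, hg⟩)) hb
    simpa [hGc] using this
  have : Algebra.FiniteType A B[X] := Algebra.FiniteType.trans (S := B) inferInstance inferInstance
  have hmap : ∀ q : Ideal A, q.map (algebraMap A B[X]) =
      (q.map (algebraMap A B)).map (Polynomial.C) := fun q => by
    rw [Ideal.map_map]; rfl
  obtain ⟨a, h1, h2, h3⟩ := lemmaB (fun x hx => by
    rw [Polynomial.algebraMap_apply, (hx.map (algebraMap A B)).eq_zero, map_zero]) G hG a₀ h₀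
  refine ⟨a, h1, h2, fun q hq b hb => ?_⟩
  obtain ⟨k, hk⟩ := h3 q hq (Polynomial.C b) (by
    rw [hmap]
    simp only [G, Finset.mul_sum, Polynomial.C_mul_monomial]
    refine Ideal.sum_mem _ fun i _ => ?_
    rw [← Polynomial.C_mul_X_pow_eq_monomial]
    exact Ideal.mul_mem_right _ _ (Ideal.mem_map_of_mem _ (hb _ (e.symm i).2)))
  refine ⟨k, ?_⟩
  rw [hmap, Ideal.mem_map_C_iff] at hk
  have := hk 0
  rw [Polynomial.algebraMap_apply, ← Polynomial.C_pow, ← Polynomial.C_mul] at this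
  rwa [Polynomial.coeff_C_zero] at this

lemma lemmaD {A B : Type*} [CommRing A] [CommRing B] [Algebra A B] [Algebra.FiniteType A B]
    [IsReduced B] (t : Finset B) (ht : Dense (PrimeSpectrum.zeroLocus (t : Set B))ᶜ)
    (a₀ : A) (h₀ : ¬ IsNilpotent a₀) :
    ∃ a, a₀ ∣ a ∧ ¬ IsNilpotent a ∧ ∀ P : PrimeSpectrum B,
      algebraMap A B a ∉ P.asIdeal → P ∈ closure ((PrimeSpectrum.zeroLocus (t : Set B))ᶜ ∩
        PrimeSpectrum.comap (algebraMap A B) ⁻¹' {PrimeSpectrum.comap (algebraMap A B) P}) := by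
  classical
  have ht' : ∀ b : B, (∀ g ∈ t, b * g = 0) → b = 0 := by
    intro b hb
    by_contra hb0
    have hne : (PrimeSpectrum.basicOpen b : Set (PrimeSpectrum B)).Nonempty := by
      rw [Set.nonempty_iff_ne_empty]
      intro h
      apply hb0
      have : PrimeSpectrum.basicOpen b = ⊥ := TopologicalSpace.Opens.ext h
      exact ((PrimeSpectrum.basicOpen_eq_bot_iff b).1 this).eq_zero
    obtain ⟨P, hP1, hP2⟩ := ht.inter_open_nonempty _ (PrimeSpectrum.basicOpen b).2 hne
    apply hP2
    intro g hg
    have : b * g ∈ P.asIdeal := by rw [hb g hg]; exact zero_mem _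
    exact (P.2.mem_or_mem this).resolve_left hP1
  obtain ⟨a, h1, h2, h3⟩ := lemmaC t ht' a₀ h₀
  refine ⟨a, h1, h2, fun P haP => ?_⟩
  set q : Ideal A := P.asIdeal.comap (algebraMap A B) with hq
  have hqp : q.IsPrime := inferInstance
  have haq : a ∉ q := haP
  -- kernel of the map to the fibre ring
  let Q : Ideal B :=
    { carrier := {z | ∃ s ∉ q, algebraMap A B s * z ∈ q.map (algebraMap A B)}
      zero_mem' := ⟨1, fun h => hqp.ne_top ((Ideal.eq_top_iff_one _).2 h), by simp⟩
      add_mem' := by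
        rintro x y ⟨s, hs, hx⟩ ⟨r, hr, hy⟩
        refine ⟨s * r, fun h => (hqp.mem_or_mem h).elim hs hr, ?_⟩
        have : algebraMap A B (s * r) * (x + y) = algebraMap A B r * (algebraMap A B s * x) +
          algebraMap A B s * (algebraMap A B r * y) := by rw [map_mul]; ring
        rw [this]
        exact Ideal.add_mem _ (Ideal.mul_mem_left _ _ hx) (Ideal.mul_mem_left _ _ hy)
      smul_mem' := by
        rintro c x ⟨s, hs, hx⟩
        refine ⟨s, hs, ?_⟩
        have : algebraMap A B s * (c • x) = c * (algebraMap A B s * x) := by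
          rw [smul_eq_mul]; ring
        rw [this]
        exact Ideal.mul_mem_left _ _ hx }
  have hQ : ∀ z, z ∈ Q ↔ ∃ s ∉ q, algebraMap A B s * z ∈ q.map (algebraMap A B) :=
    fun z => Iff.rfl
  have hQP : Q ≤ P.asIdeal := by
    rintro z ⟨s, hs, hz⟩
    have : algebraMap A B s * z ∈ P.asIdeal := Ideal.map_comap_le hz
    exact (P.2.mem_or_mem this).resolve_left hs
  have hcolon : ∀ b : B, (∀ g ∈ t, b * g ∈ Q) → b ∈ Q := by
    intro b hb
    choose! s hs hs' using hb
    have hprod : ∏ g ∈ t, s g ∉ q := by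
      intro h
      obtain ⟨g, hg, hg'⟩ := (hqp.prod_mem_iff).1 h
      exact hs g hg hg'
    obtain ⟨k, hk⟩ := h3 q hqp (algebraMap A B (∏ g ∈ t, s g) * b) (by
      intro g hg
      rw [← Finset.mul_prod_erase t s hg]
      have : algebraMap A B (s g * ∏ x ∈ t.erase g, s x) * b * g =
        algebraMap A B (∏ x ∈ t.erase g, s x) * (algebraMap A B (s g) * (b * g)) := by
        rw [map_mul]; ring
      rw [this]
      exact Ideal.mul_mem_left _ _ (hs' g hg))
    refine ⟨a ^ k * ∏ g ∈ t, s g, fun h => (hqp.mem_or_mem h).elim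
      (fun h => haq (hqp.mem_of_pow_mem _ h)) hprod, ?_⟩
    rwa [map_mul, map_pow, mul_assoc]
  have hpeel : ∀ (K : ℕ) (T : Ideal B), T * (Ideal.span (t : Set B)) ^ K ≤ Q → T ≤ Q := by
    intro K
    induction K with
    | zero => intro T hT; simpa using hT
    | succ n ih =>
      intro T hT
      rw [pow_succ', ← mul_assoc] at hT
      have h := ih _ hT
      intro b hb
      exact hcolon b fun g hg => h (Ideal.mul_mem_mul hb (Ideal.subset_span hg))
  rw [PrimeSpectrum.isTopologicalBasis_basic_opens.mem_closure_iff]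
  rintro _ ⟨h, rfl⟩ hhP
  by_contra hempty
  -- every product `h * g` lies in the radical of `Q`
  have hrad : ∀ g ∈ t, h * g ∈ Q.radical := by
    intro g hg
    by_contra hnr
    have hdisj : Disjoint ((q.map (algebraMap A B) : Ideal B) : Set B)
        ((q.primeCompl.map (algebraMap A B) ⊔ Submonoid.powers (h * g) : Submonoid B) : Set B) := by
      rw [Set.disjoint_left]
      intro z hz hz'
      obtain ⟨_, ⟨s, hs, rfl⟩, _, ⟨n, rfl⟩, rfl⟩ := Submonoid.mem_sup.1 hz'
      exact hnr ⟨n, s, hs, hz⟩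
    obtain ⟨P', hP', hle, hd⟩ := Ideal.exists_le_prime_disjoint _ _ hdisj
    rw [Set.disjoint_left] at hd
    have hhg : h * g ∉ P' := fun hm => hd hm (Submonoid.mem_sup_right (Submonoid.mem_powers _))
    apply hempty
    refine ⟨⟨P', hP'⟩, fun hm => hhg (Ideal.mul_mem_right _ _ hm), fun hm =>
      hhg (Ideal.mul_mem_left _ _ (hm hg)), ?_⟩
    apply PrimeSpectrum.ext
    change P'.comap (algebraMap A B) = q
    refine le_antisymm (fun x hx => ?_) (Ideal.map_le_iff_le_comap.1 hle)
    by_contra hxq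
    exact hd hx (Submonoid.mem_sup_left ⟨x, hxq, rfl⟩)
  have hle : Ideal.span {h} * Ideal.span (t : Set B) ≤ Q.radical := by
    rw [Ideal.span_mul_span', Ideal.span_le]
    rintro _ ⟨x, rfl, g, hg, rfl⟩
    exact hrad g hg
  obtain ⟨K, hK⟩ := Ideal.exists_pow_le_of_le_radical_of_fg hle
    (Submodule.FG.mul (Submodule.fg_span_singleton h) (Submodule.fg_span t.finite_toSet))
  rw [mul_pow] at hK
  have := hpeel K _ hK
  have h4 : h ^ K ∈ P.asIdeal :=
    hQP (this (Ideal.pow_mem_pow (Ideal.mem_span_singleton_self h) K))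
  exact hhP (P.2.mem_of_pow_mem _ h4)

lemma lemmaE {A B : Type*} [CommRing A] [CommRing B] [Algebra A B] [Algebra.FiniteType A B]
    (t : Finset B) (V : Set (PrimeSpectrum B)) (hV : IsOpen V)
    (S : Set (PrimeSpectrum B)) (hS : S = (PrimeSpectrum.zeroLocus (t : Set B))ᶜ \ V)
    (a₀ : A) (h₀ : ¬ IsNilpotent a₀) :
    ∃ a, a₀ ∣ a ∧ ¬ IsNilpotent a ∧ ∀ P ∈ closure S,
      algebraMap A B a ∉ P.asIdeal → P ∈ closure (S ∩
        PrimeSpectrum.comap (algebraMap A B) ⁻¹' {PrimeSpectrum.comap (algebraMap A B) P}) := by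
  classical
  let J := PrimeSpectrum.vanishingIdeal S
  have hJr : J.IsRadical := PrimeSpectrum.isRadical_vanishingIdeal S
  have : IsReduced (B ⧸ J) := (Ideal.isRadical_iff_quotient_reduced J).1 hJr
  let π : B →+* B ⧸ J := Ideal.Quotient.mk J
  have hπ : Function.Surjective π := Ideal.Quotient.mk_surjective
  let ι := PrimeSpectrum.comap π
  have hι : Topology.IsClosedEmbedding ι := PrimeSpectrum.isClosedEmbedding_comap_of_surjective _ _ hπ
  have hrange : Set.range ι = closure S := by
    rw [range_comap_of_surjective _ _ hπ, ← PrimeSpectrum.zeroLocus_vanishingIdeal_eq_closure,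
      Ideal.mk_ker]
  have hclV : closure S ⊆ Vᶜ := closure_minimal (by rw [hS]; exact fun x hx => hx.2)
    hV.isClosed_compl
  have hpre : (PrimeSpectrum.zeroLocus ((t.image π : Finset (B ⧸ J)) : Set (B ⧸ J)))ᶜ = ι ⁻¹' S := by
    ext x
    have hx : ι x ∈ closure S := hrange ▸ Set.mem_range_self x
    have h1 : ι x ∉ V := hclV hx
    rw [hS]
    simp only [Set.mem_compl_iff, Set.mem_preimage, Set.mem_sdiff, h1, not_false_eq_true, and_true,
      PrimeSpectrum.mem_zeroLocus, Finset.coe_image, Set.image_subset_iff]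
    rfl
  have himg : ι '' (ι ⁻¹' S) = S := by
    rw [Set.image_preimage_eq_inter_range, hrange]
    exact Set.inter_eq_left.2 subset_closure
  have hdense : Dense (PrimeSpectrum.zeroLocus ((t.image π : Finset (B ⧸ J)) : Set (B ⧸ J)))ᶜ := by
    rw [hpre]
    intro x
    rw [hι.isInducing.closure_eq_preimage_closure_image, himg, Set.mem_preimage, ← hrange]
    exact Set.mem_range_self x
  obtain ⟨a, h1, h2, h3⟩ := lemmaD (A := A) (t.image π) hdense a₀ h₀
  refine ⟨a, h1, h2, fun P hP haP => ?_⟩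
  rw [← hrange] at hP
  obtain ⟨P, rfl⟩ := hP
  have := h3 P haP
  rw [hpre, hι.isInducing.closure_eq_preimage_closure_image] at this
  refine closure_mono ?_ this
  rintro _ ⟨x, ⟨hx1, hx2⟩, rfl⟩
  exact ⟨hx1, hx2⟩

lemma lemmaF {A B : Type*} [CommRing A] [CommRing B] [Algebra A B] [Algebra.FiniteType A B]
    (t : Finset B) (V : Set (PrimeSpectrum B)) (hV : IsOpen V)
    (S : Set (PrimeSpectrum B)) (hS : S = (PrimeSpectrum.zeroLocus (t : Set B))ᶜ \ V) :
    ∃ W : Set (PrimeSpectrum A), IsOpen W ∧ Dense W ∧ ∀ P ∈ closure S,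
      PrimeSpectrum.comap (algebraMap A B) P ∈ W → P ∈ closure (S ∩
        PrimeSpectrum.comap (algebraMap A B) ⁻¹' {PrimeSpectrum.comap (algebraMap A B) P}) := by
  let W := ⋃ a ∈ {a : A | ∀ P ∈ closure S,
      algebraMap A B a ∉ P.asIdeal → P ∈ closure (S ∩
        PrimeSpectrum.comap (algebraMap A B) ⁻¹' {PrimeSpectrum.comap (algebraMap A B) P})},
      (PrimeSpectrum.basicOpen a : Set (PrimeSpectrum A))
  refine ⟨W, isOpen_biUnion fun a _ => (PrimeSpectrum.basicOpen a).2, ?_, ?_⟩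
  · rw [PrimeSpectrum.isTopologicalBasis_basic_opens.dense_iff]
    rintro _ ⟨a₀, rfl⟩ ⟨p, hp⟩
    obtain ⟨a, ⟨d, hd⟩, h2, h3⟩ := lemmaE (A := A) t V hV S hS a₀ (fun h =>
      hp (nilradical_le_prime p.asIdeal h))
    have hne : (PrimeSpectrum.basicOpen a : Set (PrimeSpectrum A)).Nonempty := by
      rw [Set.nonempty_iff_ne_empty]
      intro h
      exact h2 ((PrimeSpectrum.basicOpen_eq_bot_iff a).1 (TopologicalSpace.Opens.ext h))
    obtain ⟨x, hx⟩ := hne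
    refine ⟨x, fun hm => hx ?_, Set.mem_biUnion (x := a) h3 hx⟩
    rw [hd]
    exact Ideal.mul_mem_right _ _ hm
  · intro P hP hW
    obtain ⟨a, ha, haP⟩ := Set.mem_iUnion₂.1 hW
    exact ha P hP haP

/-- The pointwise property. -/
def Good {X Y : Scheme} (f : X ⟶ Y) (S : Set X) (y : Y) : Prop :=
  closure S ∩ (f ⁻¹' {y}) ⊆ closure (S ∩ (f ⁻¹' {y}))

lemma good_chart {X Y : Scheme} (f : X ⟶ Y) [LocallyOfFiniteType f]
    (U V : Set X) (hU : IsRetrocompactOpen U) (hV : IsOpen V)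
    {W : Y.Opens} (hW : IsAffineOpen W) {Z : X.Opens} (hZ : IsAffineOpen Z) (hZW : Z ≤ f ⁻¹ᵁ W) :
    ∃ T : Set (Spec Γ(Y, W)), IsOpen T ∧ Dense T ∧ ∀ x ∈ Z, x ∈ closure (U \ V) →
      f x ∈ hW.fromSpec '' T → x ∈ closure ((U \ V) ∩ f ⁻¹' {f x}) := by
  let φ : Γ(Y, W) →+* Γ(X, Z) := (f.appLE W Z hZW).hom
  algebraize [φ]
  have hft : φ.FiniteType := LocallyOfFiniteType.finiteType_appLE f hW hZ hZW
  have : Algebra.FiniteType Γ(Y, W) Γ(X, Z) := hft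
  have hcompact : IsCompact (hZ.fromSpec ⁻¹' U) := by
    rw [hZ.fromSpec.isOpenEmbedding.isInducing.isCompact_iff, Set.image_preimage_eq_inter_range,
      hZ.range_fromSpec]
    exact hU.2 Z.2 hZ.isCompact
  have hopen : IsOpen (hZ.fromSpec ⁻¹' U) := hU.1.preimage hZ.fromSpec.continuous
  obtain ⟨t, ht⟩ := PrimeSpectrum.isCompact_isOpen_iff.1 ⟨hcompact, hopen⟩
  obtain ⟨T, hT1, hT2, hT3⟩ := lemmaF (A := Γ(Y, W)) t (hZ.fromSpec ⁻¹' V)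
    (hV.preimage hZ.fromSpec.continuous) (hZ.fromSpec ⁻¹' (U \ V)) (by rw [ht]; rfl)
  refine ⟨T, hT1, hT2, ?_⟩
  rintro x hxZ hx ⟨q, hqT, hq⟩
  have hcomm : ∀ P : Spec Γ(X, Z), hW.fromSpec (Spec.map (f.appLE W Z hZW) P) =
      f (hZ.fromSpec P) := fun P => by
    have := IsAffineOpen.SpecMap_appLE_fromSpec f hW hZ hZW
    rw [← Scheme.Hom.comp_apply, this, Scheme.Hom.comp_apply]
  obtain ⟨P, rfl⟩ : x ∈ Set.range hZ.fromSpec := by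
    rw [hZ.range_fromSpec]; exact hxZ
  have hPq : Spec.map (f.appLE W Z hZW) P = q := by
    apply hW.fromSpec.isOpenEmbedding.injective
    rw [hcomm, hq]
  have hcl : P ∈ closure (hZ.fromSpec ⁻¹' (U \ V)) := by
    rw [← hZ.fromSpec.isOpenEmbedding.isOpenMap.preimage_closure_eq_closure_preimage
      hZ.fromSpec.continuous]
    exact hx
  have h := hT3 P hcl (by
      change Spec.map (f.appLE W Z hZW) P ∈ T
      rwa [hPq])
  have h' := image_closure_subset_closure_image hZ.fromSpec.continuous ⟨P, h, rfl⟩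
  refine closure_mono ?_ h'
  rintro _ ⟨P', ⟨h1, h2⟩, rfl⟩
  refine ⟨h1, ?_⟩
  have h3 : Spec.map (f.appLE W Z hZW) P' = Spec.map (f.appLE W Z hZW) P := h2
  rw [Set.mem_preimage, Set.mem_singleton_iff, ← hcomm, ← hcomm, h3]

lemma good_dense {X Y : Scheme} (f : X ⟶ Y) [LocallyOfFiniteType f] [QuasiCompact f]
    (U V : Set X) (hU : IsRetrocompactOpen U) (hV : IsOpen V) :
    ∃ D : Set Y, IsOpen D ∧ Dense D ∧ ∀ y ∈ D, Good f (U \ V) y := by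
  refine ⟨interior {y | Good f (U \ V) y}, isOpen_interior, ?_, fun y hy => interior_subset hy⟩
  rw [dense_iff_inter_open]
  rintro O hO ⟨y, hy⟩
  obtain ⟨W, hW, hyW, hWO⟩ := Y.isBasis_affineOpens.exists_subset_of_mem_open hy hO
  obtain ⟨W, hWa, rfl⟩ := hW
  have hWa : IsAffineOpen W := hWa
  have hc : IsCompact ((f ⁻¹ᵁ W : X.Opens) : Set X) :=
    QuasiCompact.isCompact_preimage _ W.2 hWa.isCompact
  obtain ⟨s, hs, he⟩ := (isCompact_and_isOpen_iff_finite_and_eq_biUnion_affineOpens).1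
    ⟨hc, (f ⁻¹ᵁ W).2⟩
  have hsub : ∀ Z ∈ s, Z.1 ≤ f ⁻¹ᵁ W := by
    intro Z hZ x hx
    change x ∈ ((f ⁻¹ᵁ W : X.Opens) : Set X)
    rw [he]
    exact Set.mem_biUnion hZ hx
  choose! T hT1 hT2 hT3 using fun (Z : X.affineOpens) (hZ : Z ∈ s) =>
    good_chart f U V hU hV hWa Z.2 (hsub Z hZ)
  have hD1 : IsOpen (⋂ Z ∈ s, T Z) := hs.isOpen_biInter hT1
  have hD2 : Dense (⋂ Z ∈ s, T Z) := by
    rw [← Set.sInter_image]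
    refine (hs.image T).dense_sInter ?_ ?_
    · rintro _ ⟨Z, hZ, rfl⟩; exact hT1 Z hZ
    · rintro _ ⟨Z, hZ, rfl⟩; exact hT2 Z hZ
  have hne : Nonempty (Spec Γ(Y, W)) := by
    have : y ∈ Set.range hWa.fromSpec := by rw [hWa.range_fromSpec]; exact hyW
    exact ⟨this.choose⟩
  obtain ⟨q, hq⟩ := hD2.nonempty
  have hqW : ∀ q, hWa.fromSpec q ∈ (W : Set Y) := fun q => by
    rw [← hWa.range_fromSpec]; exact Set.mem_range_self q
  refine ⟨hWa.fromSpec q, hWO (hqW q), ?_⟩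
  rw [mem_interior]
  refine ⟨hWa.fromSpec '' (⋂ Z ∈ s, T Z), ?_,
    hWa.fromSpec.isOpenEmbedding.isOpenMap _ hD1, ⟨q, hq, rfl⟩⟩
  rintro _ ⟨r, hr, rfl⟩ x ⟨hx1, hx2⟩
  have hx2 : f x = hWa.fromSpec r := hx2
  have hxW : x ∈ ((f ⁻¹ᵁ W : X.Opens) : Set X) := by
    change f x ∈ (W : Set Y)
    rw [hx2]; exact hqW r
  rw [he] at hxW
  obtain ⟨Z, hZ, hxZ⟩ := Set.mem_iUnion₂.1 hxW
  rw [← hx2]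
  exact hT3 Z hZ x hxZ hx1 ⟨r, Set.mem_iInter₂.1 hr Z hZ, hx2.symm⟩

lemma good_constructible {X Y : Scheme} (f : X ⟶ Y) [LocallyOfFiniteType f] [QuasiCompact f]
    (F : Finset (Set X × Set X)) 
    (hF : ∀ p ∈ F, IsRetrocompactOpen p.1 ∧ IsRetrocompactOpen p.2) :
    ∃ D : Set Y, IsOpen D ∧ Dense D ∧ ∀ y ∈ D, Good f (⋃ p ∈ F, p.1 \ p.2) y := by
  classical
  induction F using Finset.induction_on with
  | empty => exact ⟨Set.univ, isOpen_univ, dense_univ, fun y _ => by simp [Good]⟩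
  | insert p F hp ih =>
    obtain ⟨D, h1, h2, h3⟩ := ih fun p hp => hF p (Finset.mem_insert_of_mem hp)
    obtain ⟨h4, h5⟩ := hF p (Finset.mem_insert_self _ _)
    obtain ⟨D', h1', h2', h3'⟩ := good_dense f p.1 p.2 h4 h5.1
    refine ⟨D' ∩ D, h1'.inter h1, h2'.inter_of_isOpen_left h2 h1', fun y hy => ?_⟩
    have e1 := h3' y hy.1
    have e2 := h3 y hy.2
    rw [Finset.set_biUnion_insert]
    unfold Good at *
    rw [closure_union, Set.union_inter_distrib_right, Set.union_inter_distrib_right, closure_union]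
    exact Set.union_subset_union e1 e2

end GenFib

/-- For `f : X → Y` a finite type morphism of schemes and `S ⊆ X` constructible, there is a
dense open `U ⊆ Y` such that for `y ∈ U`, the fiberwise closure of `S ∩ f⁻¹(y)` (in the
subspace topology of the fiber) coincides with the intersection of the closure of `S` with
the fiber. -/
theorem closure_constructible_commutes_with_generic_fibers
    {X Y : Scheme} (f : X ⟶ Y) [LocallyOfFiniteType f] [QuasiCompact f]
    (S : Set X) (hS : IsConstructibleSet S) :
    ∃ U : Set Y, IsOpen U ∧ Dense U ∧ ∀ y ∈ U,
      closure S ∩ (f.base ⁻¹' {y}) =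
        Subtype.val '' closure (Subtype.val ⁻¹' S : Set (f.base ⁻¹' {y} : Set X)) := by
  obtain ⟨F, hF, rfl⟩ := hS
  obtain ⟨D, h1, h2, h3⟩ := GenFib.good_constructible f F hF
  refine ⟨D, h1, h2, fun y hy => ?_⟩
  rw [Topology.IsInducing.subtypeVal.closure_eq_preimage_closure_image,
    Subtype.image_preimage_coe, Subtype.image_preimage_coe]
  apply Set.Subset.antisymm
  · rintro x ⟨hx1, hx2⟩
    refine ⟨hx2, ?_⟩
    rw [Set.inter_comm]
    exact h3 y hy ⟨hx1, hx2⟩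
  · rintro x ⟨hx1, hx2⟩
    exact ⟨closure_mono Set.inter_subset_right hx2, hx1⟩
end

section
/- Let f : X → Y be a continuous map of sober topological spaces, let Z ⊆ X be a closed subset, let η be the generic point of an irreducible component of Y, and let s be a point of Z ∩ f⁻¹(η) that is the generic point of an irreducible component of Z ∩ f⁻¹(η) in its subspace topology. Then s is the generic point of an irreducible component of Z. -/
/-- Let `f : X → Y` be a continuous map of sober spaces, `Z ⊆ X` closed, `η` the generic
point of an irreducible component of `Y`, and `s ∈ Z ∩ f⁻¹(η)` a generic point of an
irreducible component of `Z ∩ f⁻¹(η)` (with the subspace topology).  Then `s` is a generic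
point of an irreducible component of `Z`. -/
theorem genericPoint_of_component_of_generic_fiber
    {X Y : Type*} [TopologicalSpace X] [TopologicalSpace Y]
    [QuasiSober X] [T0Space X] [QuasiSober Y] [T0Space Y]
    (f : X → Y) (hf : Continuous f) (Z : Set X) (hZ : IsClosed Z)
    (η : Y) (hη : closure {η} ∈ irreducibleComponents Y)
    (s : X) (hs : s ∈ Z ∩ f ⁻¹' {η})
    (hgen : closure {(⟨s, hs⟩ : (Z ∩ f ⁻¹' {η} : Set X))}
      ∈ irreducibleComponents (Z ∩ f ⁻¹' {η} : Set X)) :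
    closure {(⟨s, hs.1⟩ : Z)} ∈ irreducibleComponents Z := by
  refine ⟨isIrreducible_singleton.closure, fun T hT hsT => ?_⟩
  have : QuasiSober Z := hZ.isClosedEmbedding_subtypeVal.quasiSober
  obtain ⟨t, ht⟩ := QuasiSober.sober hT.closure isClosed_closure
  have ht' : closure {t} = closure T := ht
  have h1 : t ⤳ (⟨s, hs.1⟩ : Z) := by
    rw [specializes_iff_mem_closure, ht']
    exact subset_closure (hsT (subset_closure rfl))
  have h2 : (t : X) ⤳ s := h1.map continuous_subtype_val
  have h3 : f t ⤳ η := by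
    have h := h2.map hf
    rwa [show f s = η from hs.2] at h
  have h4 : closure {f t} ⊆ closure {η} :=
    hη.2 isIrreducible_singleton.closure h3.closure_subset
  have h5 : f t = η :=
    (h3.antisymm (specializes_iff_closure_subset.2 h4)).eq
  have ht2 : (t : X) ∈ Z ∩ f ⁻¹' {η} := ⟨t.2, h5⟩
  have h6 : (⟨t, ht2⟩ : (Z ∩ f ⁻¹' {η} : Set X)) ⤳ ⟨s, hs⟩ :=
    (subtype_specializes_iff _ _).2 h2
  have h7 := hgen.2 isIrreducible_singleton.closure h6.closure_subset
  have h8 : s ⤳ (t : X) :=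
    (subtype_specializes_iff _ _).1 (specializes_iff_closure_subset.2 h7)
  have h9 : (⟨s, hs.1⟩ : Z) ⤳ t := (subtype_specializes_iff _ _).2 h8
  exact (subset_closure.trans ht'.ge).trans h9.closure_subset
end
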